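/- Let V and W be nonzero finite-dimensional complex vector spaces, and let V^•(s) (s = 1, …, m) and W^•(s) (s = 1, …, m) be m-filtrations of V and of W, respectively. If both m-filtrations are semistable, then their tensor product, namely the m-filtration of V⊗W given by (V⊗W)^l(s) = Σ_{p+q=l} V^p(s)·W^q(s), is a semistable m-filtration of V⊗W. -/

import Mathlib

open scoped TensorProduct
open Module

noncomputable section

variable {V : Type*} [AddCommGroup V] [Module ℂ V]

/-- `Vf` is an `m`-filtration of `V`: each `Vf s` is a weakly decreasing chain of subspaces
starting at `V` (vanishing for large `l` is imposed separately via an explicit bound). -/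
def IsMFiltration (m : ℕ) (Vf : Fin m → ℕ → Submodule ℂ V) : Prop :=
  (∀ s, Vf s 0 = ⊤) ∧ (∀ s l, Vf s (l + 1) ≤ Vf s l)

/-- Semistability of an `m`-filtration whose terms vanish beyond `N`: for every nonzero proper
`H ⊊ V`, `(1/dim H)·Σ_s Σ_{l≥1} dim(V^l(s) ∩ H) ≤ (1/dim V)·Σ_s Σ_{l≥1} dim V^l(s)`. -/
def MFiltSemistable (m N : ℕ) (Vf : Fin m → ℕ → Submodule ℂ V) : Prop :=
  ∀ H : Submodule ℂ V, H ≠ ⊥ → H ≠ ⊤ →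
    (∑ s : Fin m, ∑ l ∈ Finset.Icc 1 N, (finrank ℂ ↥(Vf s l ⊓ H) : ℚ)) /
        (finrank ℂ ↥H : ℚ) ≤
      (∑ s : Fin m, ∑ l ∈ Finset.Icc 1 N, (finrank ℂ ↥(Vf s l) : ℚ)) / (finrank ℂ V : ℚ)

/-- For `A ⊆ V` and `B ⊆ W`, the subspace `A·B ⊆ V ⊗ W`: the image of `A ⊗ B` in `V ⊗ W`
under the canonical map. -/
def prodSub {W : Type*} [AddCommGroup W] [Module ℂ W]
    (A : Submodule ℂ V) (B : Submodule ℂ W) : Submodule ℂ (V ⊗[ℂ] W) :=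
  LinearMap.range (TensorProduct.map A.subtype B.subtype)

section Helpers
open scoped ComplexOrder

open Matrix in
lemma aux_quad_apply {n d e : ℕ} (A : Matrix (Fin d) (Fin n) ℂ) (B : Matrix (Fin n) (Fin e) ℂ)
    (w : Fin n → ℂ) (x : Fin d) (y : Fin e) :
    (A * diagonal w * B) x y = ∑ i, A x i * w i * B i y := by
  rw [Matrix.mul_apply]
  simp only [mul_diagonal]

open Matrix in
lemma aux_det_one_add {d : ℕ} {X : Matrix (Fin d) (Fin d) ℂ} (hX : X.PosSemidef) :
    1 ≤ ‖(1 + X).det‖ := by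
  have hX' := hX.1
  have h1 : (1 + X).IsHermitian := by
    exact Matrix.isHermitian_one.add hX'
  rw [h1.det_eq_prod_eigenvalues, norm_prod]
  refine (Finset.prod_const_one (s := Finset.univ) (ι := Fin d)).symm.le.trans
    (Finset.prod_le_prod (fun _ _ => zero_le_one) fun i _ => ?_)
  have : 1 ≤ h1.eigenvalues i := by
    rw [h1.eigenvalues_eq i]
    rw [Matrix.add_mulVec, Matrix.one_mulVec, dotProduct_add, map_add]
    have h2 := hX.re_dotProduct_nonneg (h1.eigenvectorBasis i).ofLp
    have h3 : (star (h1.eigenvectorBasis i).ofLp) ⬝ᵥ (h1.eigenvectorBasis i).ofLp = 1 := by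
      rw [dotProduct_comm, ← EuclideanSpace.inner_eq_star_dotProduct]
      simp
    rw [h3]
    simpa using h2
  simp only [Complex.coe_algebraMap, RCLike.norm_ofReal]
  simpa using this.trans (le_abs_self _)

open Matrix in
lemma aux_det_mono {d : ℕ} {A B : Matrix (Fin d) (Fin d) ℂ} (hA : A.PosSemidef)
    (hB : B.PosSemidef) : ‖A.det‖ ≤ ‖(A + B).det‖ := by
  by_cases h0 : A.det = 0
  · rw [h0]; simp
  obtain ⟨g, hg⟩ : ∃ g : Matrix (Fin d) (Fin d) ℂ, A = gᴴ * g := by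
    open scoped MatrixOrder in
    exact CStarAlgebra.nonneg_iff_eq_star_mul_self.mp (Matrix.nonneg_iff_posSemidef.mpr hA)
  have hgd : IsUnit g.det := by
    rw [isUnit_iff_ne_zero]
    intro h; apply h0; rw [hg, det_mul, h, mul_zero]
  have hX := hB.conjTranspose_mul_mul_same g⁻¹
  have hX1 := aux_det_one_add hX
  have : A + B = gᴴ * (1 + (g⁻¹)ᴴ * B * g⁻¹) * g := by
    have e1 : gᴴ * (g⁻¹)ᴴ = 1 := by
      rw [← conjTranspose_mul, Matrix.nonsing_inv_mul _ hgd, conjTranspose_one]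
    rw [Matrix.mul_add, Matrix.add_mul, Matrix.mul_one, hg]
    congr 1
    calc B = (gᴴ * (g⁻¹)ᴴ) * B * (g⁻¹ * g) := by
          rw [e1, Matrix.nonsing_inv_mul _ hgd, Matrix.one_mul, Matrix.mul_one]
      _ = _ := by simp only [Matrix.mul_assoc]
  rw [this, det_mul, det_mul, hg, det_mul, norm_mul, norm_mul, norm_mul]
  nlinarith [norm_nonneg (gᴴ.det), norm_nonneg g.det, mul_nonneg (norm_nonneg (gᴴ.det)) (norm_nonneg g.det)]

open Matrix in
lemma aux_gram_lower {n d : ℕ} (B : Matrix (Fin n) (Fin d) ℂ) (lam : Fin n → ℝ)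
    (hl : ∀ i, 0 ≤ lam i) (ι : Fin d → Fin n) (hι : Function.Injective ι) :
    (∏ a, lam (ι a)) * ‖(B.submatrix ι id).det‖ ^ 2 ≤
      ‖(Bᴴ * diagonal (fun i => (lam i : ℂ)) * B).det‖ := by
  classical
  set D' : Matrix (Fin n) (Fin n) ℂ :=
    diagonal (fun i => ((if i ∈ Set.range ι then 0 else lam i : ℝ) : ℂ)) with hD'
  set Bi := B.submatrix ι id with hBi
  have e : Bᴴ * diagonal (fun i => (lam i : ℂ)) * B =
      Biᴴ * diagonal (fun a => (lam (ι a) : ℂ)) * Bi + Bᴴ * D' * B := by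
    ext x y
    rw [Matrix.add_apply, hD', aux_quad_apply, aux_quad_apply, aux_quad_apply]
    simp only [hBi, conjTranspose_apply, submatrix_apply, id]
    have : ∑ a, star (B (ι a) x) * (lam (ι a) : ℂ) * B (ι a) y =
        ∑ i, if i ∈ Set.range ι then star (B i x) * (lam i : ℂ) * B i y else 0 := by
      rw [← Finset.sum_filter]
      have : (Finset.univ.filter (fun i => i ∈ Set.range ι)) = Finset.univ.image ι := by
        ext; simp
      rw [this, Finset.sum_image (fun _ _ _ _ h => hι h)]
    rw [this, ← Finset.sum_add_distrib]
    refine Finset.sum_congr rfl fun i _ => ?_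
    split_ifs <;> simp
  have h1 : (Biᴴ * diagonal (fun a => (lam (ι a) : ℂ)) * Bi).PosSemidef := by
    apply PosSemidef.conjTranspose_mul_mul_same
    apply PosSemidef.diagonal
    intro a; simpa using hl (ι a)
  have h2 : (Bᴴ * D' * B).PosSemidef := by
    apply PosSemidef.conjTranspose_mul_mul_same
    apply PosSemidef.diagonal
    intro i
    have : (0:ℝ) ≤ if i ∈ Set.range ι then 0 else lam i := by split_ifs; exact le_rfl; exact hl i
    exact Complex.zero_le_real.mpr this
  rw [e]
  refine le_trans (le_of_eq ?_) (aux_det_mono h1 h2)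
  rw [det_mul, det_mul, det_conjTranspose, det_diagonal, norm_mul, norm_mul, norm_star, norm_prod]
  have : ∀ a, ‖(lam (ι a) : ℂ)‖ = lam (ι a) := fun a => by
    rw [Complex.norm_real, Real.norm_of_nonneg (hl _)]
  simp only [this]
  ring

open Matrix in
lemma aux_spectral {n : ℕ} {h : Matrix (Fin n) (Fin n) ℂ} (hh : h.PosDef) :
    ∃ Q ∈ Matrix.unitaryGroup (Fin n) ℂ, ∃ lam : Fin n → ℝ, Antitone lam ∧ (∀ i, 0 < lam i) ∧
      h = Qᴴ * diagonal (fun i => (lam i : ℂ)) * Q := by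
  classical
  set ev := hh.1.eigenvalues with hev
  set U : Matrix (Fin n) (Fin n) ℂ := (hh.1.eigenvectorUnitary : Matrix (Fin n) (Fin n) ℂ) with hU
  have hUm : U ∈ Matrix.unitaryGroup (Fin n) ℂ := hh.1.eigenvectorUnitary.2
  set σ := Tuple.sort (fun i => - ev i) with hσ
  have hmono : Monotone ((fun i => - ev i) ∘ σ) := Tuple.monotone_sort _
  have hs : h = U * diagonal (fun i => (ev i : ℂ)) * Uᴴ := by
    have := hh.1.spectral_theorem
    rw [Unitary.conjStarAlgAut_apply] at this
    exact this
  refine ⟨Uᴴ.submatrix σ id, ?_, ev ∘ σ, ?_, ?_, ?_⟩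
  · rw [Matrix.mem_unitaryGroup_iff]
    have : Uᴴ * U = 1 := Matrix.mem_unitaryGroup_iff'.mp hUm
    rw [star_eq_conjTranspose, conjTranspose_submatrix, conjTranspose_conjTranspose]
    ext i j
    have := congrFun (congrFun this (σ i)) (σ j)
    simpa [Matrix.mul_apply, Matrix.one_apply] using this
  · intro i j hij
    have := hmono hij
    simp only [Function.comp] at this ⊢
    linarith
  · intro i; exact hh.eigenvalues_pos _
  · rw [hs]
    ext x y
    rw [aux_quad_apply, aux_quad_apply]
    simp only [conjTranspose_apply, submatrix_apply, id, star_star,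
      Function.comp]
    exact (Equiv.sum_comp σ (fun i => U x i * (ev i : ℂ) * star (U y i))).symm


/-- greedy selection -/
lemma aux_greedy {n d : ℕ} {X : Type*} [AddCommGroup X] [Module ℂ X] [FiniteDimensional ℂ X]
    (hd : finrank ℂ X = d)
    (r : Fin n → X) (hr : Submodule.span ℂ (Set.range r) = ⊤) :
    ∃ ι : Fin d → Fin n, Function.Injective ι ∧ LinearIndependent ℂ (r ∘ ι) ∧
      ∀ k : ℕ, (Finset.univ.filter (fun a => (ι a : ℕ) < k)).card =
        finrank ℂ (Submodule.span ℂ (r '' {i | (i : ℕ) < k})) := by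
  classical
  set S : ℕ → Submodule ℂ X := fun k => Submodule.span ℂ (r '' {i | (i : ℕ) < k}) with hS
  set I : Finset (Fin n) := Finset.univ.filter (fun i => r i ∉ S i) with hI
  have hSn : ∀ k, n ≤ k → S k = ⊤ := by
    intro k hk
    have h1 : {i : Fin n | (i : ℕ) < k} = Set.univ := by
      ext i; simp; omega
    change Submodule.span ℂ (r '' {i | (i : ℕ) < k}) = ⊤
    rw [h1, Set.image_univ, hr]
  have hins : ∀ k (hk : k < n), S (k+1) = Submodule.span ℂ {r ⟨k, hk⟩} ⊔ S k := by
    intro k hk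
    have h1 : {i : Fin n | (i : ℕ) < k + 1} = {⟨k, hk⟩} ∪ {i : Fin n | (i : ℕ) < k} := by
      ext i
      simp [Fin.ext_iff]; omega
    change Submodule.span ℂ (r '' {i | (i : ℕ) < k + 1}) =
      _ ⊔ Submodule.span ℂ (r '' {i | (i : ℕ) < k})
    rw [h1, Set.image_union, Set.image_singleton, Submodule.span_union]
  have hfilt : ∀ k (hk : k < n), I.filter (fun i : Fin n => (i:ℕ) < k+1) =
      if r ⟨k, hk⟩ ∉ S k then insert ⟨k, hk⟩ (I.filter (fun i : Fin n => (i:ℕ) < k))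
      else I.filter (fun i : Fin n => (i:ℕ) < k) := by
    intro k hk
    by_cases h : r ⟨k, hk⟩ ∉ S k
    · rw [if_pos h]
      ext i
      simp only [hI, Finset.mem_filter, Finset.mem_univ, true_and, Finset.mem_insert]
      constructor
      · rintro ⟨h1, h2⟩
        rcases Nat.lt_succ_iff_lt_or_eq.mp h2 with h3 | h3
        · exact Or.inr ⟨h1, h3⟩
        · left; ext; exact h3
      · rintro (rfl | ⟨h1, h2⟩)
        · exact ⟨h, Nat.lt_succ_self _⟩
        · exact ⟨h1, by omega⟩
    · rw [if_neg h]
      ext i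
      simp only [hI, Finset.mem_filter, Finset.mem_univ, true_and]
      constructor
      · rintro ⟨h1, h2⟩
        refine ⟨h1, ?_⟩
        rcases Nat.lt_succ_iff_lt_or_eq.mp h2 with h3 | h3
        · exact h3
        · exfalso
          have : i = ⟨k, hk⟩ := Fin.ext h3
          subst this
          exact h h1
      · rintro ⟨h1, h2⟩
        exact ⟨h1, by omega⟩
  have hcard : ∀ k, k ≤ n → (I.filter (fun i : Fin n => (i:ℕ) < k)).card = finrank ℂ (S k) ∧
      Submodule.span ℂ (r '' (I.filter (fun i : Fin n => (i:ℕ) < k) : Finset (Fin n))) = S k := by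
    intro k
    induction k with
    | zero => 
      intro _
      have : S 0 = ⊥ := by simp [hS]
      rw [this]
      simp
    | succ k ih =>
      intro hk
      obtain ⟨ih1, ih2⟩ := ih (by omega)
      have hk' : k < n := by omega
      rw [hfilt k hk', hins k hk']
      by_cases h : r ⟨k, hk'⟩ ∉ S k
      · rw [if_pos h]
        constructor
        · rw [Finset.card_insert_of_notMem (by simp), ih1]
          have hne : r ⟨k, hk'⟩ ≠ 0 := fun h0 => h (by rw [h0]; exact zero_mem _)
          have hdis : Disjoint (Submodule.span ℂ {r ⟨k, hk'⟩}) (S k) := by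
            exact ((Submodule.disjoint_span_singleton' hne).mpr h).symm
          have := Submodule.finrank_sup_add_finrank_inf_eq (Submodule.span ℂ {r ⟨k, hk'⟩}) (S k)
          rw [disjoint_iff.mp hdis, finrank_bot, finrank_span_singleton hne] at this
          omega
        · rw [Finset.coe_insert, Set.image_insert_eq, Submodule.span_insert, ih2]
      · rw [if_neg h]
        rw [not_not] at h
        have : Submodule.span ℂ {r ⟨k, hk'⟩} ⊔ S k = S k := by
          rw [sup_eq_right, Submodule.span_singleton_le_iff_mem]
          exact h
        rw [this]
        exact ⟨ih1, ih2⟩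
  have hIn : I.filter (fun i : Fin n => (i:ℕ) < n) = I := by
    ext i; simp
  obtain ⟨hc, hsp⟩ := hcard n le_rfl
  rw [hIn, hSn n le_rfl] at hc hsp
  rw [finrank_top, hd] at hc
  refine ⟨I.orderEmbOfFin hc, (I.orderEmbOfFin hc).injective, ?_, ?_⟩
  · apply linearIndependent_of_top_le_span_of_card_eq_finrank
    · rw [Set.range_comp, Finset.range_orderEmbOfFin, hsp]
    · simp [hd]
  · intro k
    have h1 : (Finset.univ.filter (fun a => ((I.orderEmbOfFin hc a : Fin n) : ℕ) < k)).card =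
        (I.filter (fun i : Fin n => (i:ℕ) < k)).card := by
      rw [← Finset.card_image_of_injective _ (I.orderEmbOfFin hc).injective]
      congr 1
      ext i
      simp only [Finset.mem_image, Finset.mem_filter, Finset.mem_univ, true_and]
      constructor
      · rintro ⟨a, h1, rfl⟩
        exact ⟨Finset.orderEmbOfFin_mem _ _ _, h1⟩
      · rintro ⟨h1, h2⟩
        have : i ∈ Set.range (I.orderEmbOfFin hc) := by
          rw [Finset.range_orderEmbOfFin]; exact h1
        obtain ⟨a, rfl⟩ := this
        exact ⟨a, h2, rfl⟩
    rw [h1]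
    by_cases hk : k ≤ n
    · exact (hcard k hk).1
    · have e1 : I.filter (fun i : Fin n => (i:ℕ) < k) = I := by
        ext i; simp; intro _; omega
      have := hSn k (by omega)
      simp only [hS] at this
      rw [e1, this, finrank_top, hc, hd]

lemma aux_abel {n : ℕ} {J : Type*} [Fintype J] (d : J → ℕ) (ι : ∀ j, Fin (d j) → Fin n) (μ : ℝ)
    (hc : ∀ k : ℕ, k ≤ n →
      μ * k ≤ ∑ j, ((Finset.univ.filter (fun a => (ι j a : ℕ) < k)).card : ℝ))
    (htot : ∑ j, (d j : ℝ) = μ * n) (x : Fin n → ℝ) (hx : Antitone x) :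
    μ * ∑ i, x i ≤ ∑ j, ∑ a, x (ι j a) := by
  classical
  rcases Nat.eq_zero_or_pos n with rfl | hn
  · have : ∀ j, IsEmpty (Fin (d j)) := fun j => ⟨fun a => (ι j a).elim0⟩
    simp
  -- extension of x to ℕ
  set y : ℕ → ℝ := fun k => x ⟨min k (n-1), by omega⟩ with hy
  have hyx : ∀ i : Fin n, x i = y i := by
    intro i; simp only [hy]; congr 1; ext; simp; omega
  have hya : Antitone y := by
    intro a b hab
    apply hx
    simp only [Fin.mk_le_mk]
    exact min_le_min_right _ hab
  have hlayer : ∀ i : Fin n, x i = y (n-1) + ∑ k ∈ Finset.range (n-1),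
      (y k - y (k+1)) * (if (i:ℕ) < k+1 then 1 else 0) := by
    intro i
    have : ∀ m, (i:ℕ) ≤ m → y i = y m + ∑ k ∈ Finset.range m,
      (y k - y (k+1)) * (if (i:ℕ) < k+1 then 1 else 0) := by
      intro m hm
      induction m, hm using Nat.le_induction with
      | base =>
        rw [Finset.sum_eq_zero, add_zero]
        intro k hk
        rw [Finset.mem_range] at hk
        rw [if_neg (by omega), mul_zero]
      | succ m hm ih =>
        rw [Finset.sum_range_succ, if_pos (by omega), ih]; ring
    rw [hyx]
    exact this _ (by omega)
  have hR : ∑ j, ∑ a, x (ι j a) = y (n-1) * (μ * n) + ∑ k ∈ Finset.range (n-1), (y k - y (k+1)) *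
      ∑ j, ((Finset.univ.filter (fun a => (ι j a : ℕ) < k+1)).card : ℝ) := by
    simp_rw [fun j a => hlayer (ι j a), Finset.sum_add_distrib]
    congr 1
    · rw [← htot, Finset.mul_sum]
      simp [mul_comm]
    · simp_rw [Finset.mul_sum]
      rw [Finset.sum_comm (s := Finset.range (n-1))]
      refine Finset.sum_congr rfl fun j _ => ?_
      rw [Finset.sum_comm]
      refine Finset.sum_congr rfl fun k _ => ?_
      rw [← Finset.mul_sum]; simp
  have hL : ∑ i, x i = y (n-1) * n + ∑ k ∈ Finset.range (n-1), (y k - y (k+1)) * ((k+1 : ℕ) : ℝ) := by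
    simp_rw [hlayer, Finset.sum_add_distrib]
    congr 1
    · simp [mul_comm]
    · rw [Finset.sum_comm]
      refine Finset.sum_congr rfl fun k hk => ?_
      rw [← Finset.mul_sum]
      congr 1
      rw [Finset.mem_range] at hk
      have : (Finset.univ.filter (fun i : Fin n => (i:ℕ) < k+1)).card = k+1 := by
        rw [Fin.card_filter_val_lt]; omega
      simp only [Finset.sum_boole, this]
  rw [hR, hL, mul_add, Finset.mul_sum]
  have : ∑ k ∈ Finset.range (n-1), μ * ((y k - y (k+1)) * ((k+1 : ℕ) : ℝ)) ≤
    ∑ k ∈ Finset.range (n-1), (y k - y (k+1)) *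
      ∑ j, ((Finset.univ.filter (fun a => (ι j a : ℕ) < k+1)).card : ℝ) := by
    refine Finset.sum_le_sum fun k hk => ?_
    rw [Finset.mem_range] at hk
    have h1 := hc (k+1) (by omega)
    have h2 : 0 ≤ y k - y (k+1) := sub_nonneg.mpr (hya (Nat.le_succ k))
    nlinarith
  nlinarith


open Matrix in
lemma aux_exists_adm {n : ℕ} {J : Type*} [Fintype J] (d : J → ℕ)
    (M : ∀ j, Matrix (Fin n) (Fin (d j)) ℂ) (hM : ∀ j, Function.Injective (M j).mulVec) (μ : ℝ)
    (hss : ∀ H : Submodule ℂ (Fin n → ℂ),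
      ∑ j, (finrank ℂ ↥(LinearMap.range (M j).mulVecLin ⊓ H) : ℝ) ≤ μ * finrank ℂ H)
    (htot : ∑ j, (d j : ℝ) = μ * n)
    (Q : Matrix (Fin n) (Fin n) ℂ) (hQ : IsUnit Q) :
    ∃ ι : ∀ j, Fin (d j) → Fin n, (∀ j, Function.Injective (ι j)) ∧
      (∀ k : ℕ, k ≤ n →
        μ * k ≤ ∑ j, ((Finset.univ.filter (fun a => (ι j a : ℕ) < k)).card : ℝ)) ∧
      ∀ j, ((Q * M j).submatrix (ι j) id).det ≠ 0 := by
  classical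
  have hQi : Function.Injective Q.mulVec := Matrix.mulVec_injective_iff_isUnit.mpr hQ
  have hB : ∀ j, Function.Injective (Q * M j).mulVec := by
    intro j x y hxy
    rw [← Matrix.mulVec_mulVec, ← Matrix.mulVec_mulVec] at hxy
    exact hM j (hQi hxy)
  have hspan : ∀ j, Submodule.span ℂ (Set.range (Q * M j).row) = ⊤ := by
    intro j
    apply Submodule.eq_top_of_finrank_eq
    rw [← Matrix.rank_eq_finrank_span_row, Matrix.rank]
    rw [LinearMap.finrank_range_of_inj (show Function.Injective (Q * M j).mulVecLin from hB j)]
  choose ι hι1 hι2 hι3 using fun j => aux_greedy (d := d j) (by simp) (Q * M j).row (hspan j)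
  refine ⟨ι, hι1, ?_, ?_⟩
  · intro k hk
    set Qk : Matrix {i : Fin n // (i:ℕ) < k} (Fin n) ℂ := Q.submatrix Subtype.val id with hQk
    set H : Submodule ℂ (Fin n → ℂ) := LinearMap.ker Qk.mulVecLin with hH
    have hHr : (finrank ℂ H : ℝ) = n - k := by
      have h1 := LinearMap.finrank_range_add_finrank_ker Qk.mulVecLin
      have h2 : finrank ℂ (LinearMap.range Qk.mulVecLin) = k := by
        have h3 : LinearIndependent ℂ Qk.row := by
          have := Matrix.linearIndependent_rows_of_isUnit hQ
          exact this.comp _ Subtype.val_injective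
        have h4 := h3.rank_matrix
        rw [Matrix.rank] at h4
        rw [h4, Fintype.card_subtype, Fin.card_filter_val_lt]; omega
      rw [h2] at h1
      simp only [Module.finrank_pi, Fintype.card_fin] at h1
      have : ((k + finrank ℂ H : ℕ) : ℝ) = n := by exact_mod_cast h1
      push_cast at this
      linarith
    have hj : ∀ j, (d j : ℝ) ≤ ((Finset.univ.filter (fun a => (ι j a : ℕ) < k)).card : ℝ) +
        finrank ℂ ↥(LinearMap.range (M j).mulVecLin ⊓ H) := by
      intro j
      rw [hι3 j k]
      set Bk : Matrix {i : Fin n // (i:ℕ) < k} (Fin (d j)) ℂ :=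
        (Q * M j).submatrix Subtype.val id with hBk
      have e1 : (Q * M j).row '' {i | (i:ℕ) < k} = Set.range Bk.row := by
        ext v
        simp only [Set.mem_image, Set.mem_ofPred_eq, Set.mem_range, Subtype.exists]
        constructor
        · rintro ⟨i, hi, rfl⟩; exact ⟨i, hi, rfl⟩
        · rintro ⟨i, hi, rfl⟩; exact ⟨i, hi, rfl⟩
      rw [e1, ← Matrix.rank_eq_finrank_span_row, Matrix.rank]
      have h1 := LinearMap.finrank_range_add_finrank_ker Bk.mulVecLin
      simp only [Module.finrank_pi, Fintype.card_fin] at h1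
      have hBkQ : Bk = Qk * M j := by
        ext i x; simp [hBk, hQk, Matrix.mul_apply]
      have h2 : finrank ℂ (LinearMap.ker Bk.mulVecLin) ≤
          finrank ℂ ↥(LinearMap.range (M j).mulVecLin ⊓ H) := by
        have h3 : (LinearMap.ker Bk.mulVecLin).map (M j).mulVecLin ≤
            LinearMap.range (M j).mulVecLin ⊓ H := by
          rintro _ ⟨x, hx, rfl⟩
          refine ⟨⟨x, rfl⟩, ?_⟩
          simp only [SetLike.mem_coe, LinearMap.mem_ker, Matrix.mulVecLin_apply, hBkQ,
            ← Matrix.mulVec_mulVec] at hx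
          simpa [hH] using hx
        have h4 := Submodule.finrank_mono h3
        rwa [← (Submodule.equivMapOfInjective (M j).mulVecLin (hM j) _).finrank_eq] at h4
      have : d j ≤ finrank ℂ (LinearMap.range Bk.mulVecLin) +
        finrank ℂ ↥(LinearMap.range (M j).mulVecLin ⊓ H) := by omega
      exact_mod_cast this
    have h5 := Finset.sum_le_sum (fun j (_ : j ∈ Finset.univ) => hj j)
    rw [Finset.sum_add_distrib, htot] at h5
    have h6 := hss H
    rw [hHr] at h6
    linarith
  · intro j
    have := hι2 j
    have h2 : LinearIndependent ℂ ((Q * M j).submatrix (ι j) id).row := this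
    rw [Matrix.linearIndependent_rows_iff_isUnit, Matrix.isUnit_iff_isUnit_det] at h2
    exact h2.ne_zero

open Matrix in
lemma aux_compact {n : ℕ} {J : Type*} [Fintype J] (d : J → ℕ)
    (M : ∀ j, Matrix (Fin n) (Fin (d j)) ℂ) (P : (∀ j, Fin (d j) → Fin n) → Prop)
    (h : ∀ Q ∈ Matrix.unitaryGroup (Fin n) ℂ, ∃ ι : ∀ j, Fin (d j) → Fin n, P ι ∧
      ∀ j, ((Q * M j).submatrix (ι j) id).det ≠ 0) :
    ∃ c : ℝ, 0 < c ∧ ∀ Q ∈ Matrix.unitaryGroup (Fin n) ℂ, ∃ ι : ∀ j, Fin (d j) → Fin n, P ι ∧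
      c ≤ ∏ j, ‖((Q * M j).submatrix (ι j) id).det‖ ^ 2 := by
  classical
  have hK : IsCompact {Q : Matrix (Fin n) (Fin n) ℂ | Q ∈ Matrix.unitaryGroup (Fin n) ℂ} := by
    have hbig : IsCompact (Set.pi Set.univ fun _ : Fin n => Set.pi Set.univ
        fun _ : Fin n => Metric.closedBall (0:ℂ) 1) :=
      isCompact_univ_pi fun _ => isCompact_univ_pi fun _ => isCompact_closedBall _ _
    refine hbig.of_isClosed_subset ?_ ?_
    · have : {Q : Matrix (Fin n) (Fin n) ℂ | Q ∈ Matrix.unitaryGroup (Fin n) ℂ} =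
          {Q | Q * star Q = 1} := by
        ext Q; exact Matrix.mem_unitaryGroup_iff
      rw [this]
      exact isClosed_eq (by fun_prop) continuous_const
    · intro Q hQ i _ j _
      simpa using entry_norm_bound_of_unitary hQ i j
  refine hK.induction_on (p := fun S => ∃ c : ℝ, 0 < c ∧ ∀ Q ∈ S,
    ∃ ι : ∀ j, Fin (d j) → Fin n, P ι ∧
      c ≤ ∏ j, ‖((Q * M j).submatrix (ι j) id).det‖ ^ 2) ?_ ?_ ?_ ?_
  · exact ⟨1, one_pos, fun _ h => h.elim⟩
  · rintro s t hst ⟨c, hc, h⟩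
    exact ⟨c, hc, fun Q hQ => h Q (hst hQ)⟩
  · rintro s t ⟨c, hc, h⟩ ⟨c', hc', h'⟩
    refine ⟨min c c', lt_min hc hc', ?_⟩
    rintro Q (hQ | hQ)
    · obtain ⟨ι, h1, h2⟩ := h Q hQ
      exact ⟨ι, h1, (min_le_left _ _).trans h2⟩
    · obtain ⟨ι, h1, h2⟩ := h' Q hQ
      exact ⟨ι, h1, (min_le_right _ _).trans h2⟩
  · intro Q0 hQ0
    obtain ⟨ι, hP, hdet⟩ := h Q0 hQ0
    have hcont : Continuous fun Q : Matrix (Fin n) (Fin n) ℂ =>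
        ∏ j, ‖((Q * M j).submatrix (ι j) id).det‖ ^ 2 := by
      refine continuous_finsetProd _ fun j _ => ?_
      refine (Continuous.norm ?_).pow 2
      refine Continuous.matrix_det ?_
      refine Continuous.matrix_submatrix ?_ _ _
      fun_prop
    have hpos : 0 < ∏ j, ‖((Q0 * M j).submatrix (ι j) id).det‖ ^ 2 :=
      Finset.prod_pos fun j _ => by have := norm_pos_iff.mpr (hdet j); positivity
    refine ⟨{Q | (∏ j, ‖((Q0 * M j).submatrix (ι j) id).det‖ ^ 2) / 2 <
      ∏ j, ‖((Q * M j).submatrix (ι j) id).det‖ ^ 2}, ?_, _, half_pos hpos,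
      fun Q hQ => ⟨ι, hP, le_of_lt hQ⟩⟩
    apply mem_nhdsWithin_of_mem_nhds
    exact (isOpen_lt continuous_const hcont).mem_nhds (half_lt_self hpos)


open Matrix in
lemma aux_lower {n : ℕ} {J : Type*} [Fintype J] (d : J → ℕ)
    (M : ∀ j, Matrix (Fin n) (Fin (d j)) ℂ) (hM : ∀ j, Function.Injective (M j).mulVec) (μ : ℝ)
    (hss : ∀ H : Submodule ℂ (Fin n → ℂ),
      ∑ j, (finrank ℂ ↥(LinearMap.range (M j).mulVecLin ⊓ H) : ℝ) ≤ μ * finrank ℂ H)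
    (htot : ∑ j, (d j : ℝ) = μ * n) :
    ∃ C : ℝ, ∀ h : Matrix (Fin n) (Fin n) ℂ, h.PosDef →
      C ≤ ∑ j, Real.log ‖((M j)ᴴ * h * M j).det‖ - μ * Real.log ‖h.det‖ := by
  classical
  obtain ⟨c, hc, hQ⟩ := aux_compact d M
    (fun ι => (∀ j, Function.Injective (ι j)) ∧ (∀ k : ℕ, k ≤ n →
        μ * k ≤ ∑ j, ((Finset.univ.filter (fun a => (ι j a : ℕ) < k)).card : ℝ)))
    (fun Q hQ => by
      have hu : IsUnit Q := by
        refine (Matrix.isUnit_iff_isUnit_det Q).mpr ?_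
        exact Matrix.isUnit_det_of_right_inverse (Matrix.mem_unitaryGroup_iff.mp hQ)
      obtain ⟨ι, h1, h2, h3⟩ := aux_exists_adm d M hM μ hss htot Q hu
      exact ⟨ι, ⟨h1, h2⟩, h3⟩)
  refine ⟨Real.log c, fun h hh => ?_⟩
  obtain ⟨Q, hQu, lam, hanti, hpos, rfl⟩ := aux_spectral hh
  obtain ⟨ι, ⟨hι1, hι2⟩, hι3⟩ := hQ Q hQu
  have hne : ∀ j, 0 < ‖((Q * M j).submatrix (ι j) id).det‖ ^ 2 := by
    intro j
    have h1 : ∏ j, ‖((Q * M j).submatrix (ι j) id).det‖ ^ 2 ≠ 0 := (hc.trans_le hι3).ne'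
    have := Finset.prod_ne_zero_iff.mp h1 j (Finset.mem_univ _)
    exact lt_of_le_of_ne (by positivity) this.symm
  have hj : ∀ j, ∑ a, Real.log (lam (ι j a)) +
      Real.log (‖((Q * M j).submatrix (ι j) id).det‖ ^ 2) ≤
      Real.log ‖((M j)ᴴ * (Qᴴ * diagonal (fun i => (lam i : ℂ)) * Q) * M j).det‖ := by
    intro j
    rw [← Real.log_prod (fun a _ => (hpos _).ne'), ← Real.log_mul
      (Finset.prod_pos fun a _ => hpos _).ne' (hne j).ne']
    apply Real.log_le_log (mul_pos (Finset.prod_pos fun a _ => hpos _) (hne j))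
    have := aux_gram_lower (Q * M j) lam (fun i => (hpos i).le) (ι j) (hι1 j)
    rw [conjTranspose_mul] at this
    simpa only [Matrix.mul_assoc] using this
  have hdet : Real.log ‖(Qᴴ * diagonal (fun i => (lam i : ℂ)) * Q).det‖ =
      ∑ i, Real.log (lam i) := by
    rw [← Real.log_prod (fun a _ => (hpos _).ne')]
    congr 1
    have h1 : Qᴴ * Q = 1 := Matrix.mem_unitaryGroup_iff'.mp hQu
    have h2 : ‖Qᴴ.det‖ * ‖Q.det‖ = 1 := by
      rw [← norm_mul, ← det_mul, h1]; simp
    rw [det_mul, det_mul, norm_mul, norm_mul, mul_right_comm, h2, one_mul, det_diagonal, norm_prod]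
    refine Finset.prod_congr rfl fun i _ => ?_
    rw [Complex.norm_real, Real.norm_of_nonneg (hpos _).le]
  have hab := aux_abel d ι μ hι2 htot (fun i => Real.log (lam i)) (fun i j hij =>
    Real.log_le_log (hpos _) (hanti hij))
  have hlc : Real.log c ≤ ∑ j, Real.log (‖((Q * M j).submatrix (ι j) id).det‖ ^ 2) := by
    rw [← Real.log_prod (fun j _ => (hne j).ne')]
    exact Real.log_le_log hc hι3
  have hsum := Finset.sum_le_sum (fun j (_ : j ∈ Finset.univ) => hj j)
  rw [Finset.sum_add_distrib] at hsum
  rw [hdet]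
  linarith

open Matrix in
lemma aux_step {n d : ℕ} (B : Matrix (Fin n) (Fin d) ℂ) (hB : Function.Injective B.mulVec)
    (v : Matrix (Fin n) (Fin 1) ℂ) (t : ℝ)
    (hS : (1 - (t : ℂ) • (v * vᴴ)).PosDef) :
    Real.log ‖(Bᴴ * (1 - (t : ℂ) • (v * vᴴ)) * B).det‖ ≤
      Real.log ‖(Bᴴ * B).det‖ - t * ((vᴴ * (B * (Bᴴ * B)⁻¹ * Bᴴ) * v) 0 0).re := by
  have hA : (Bᴴ * B).PosDef := PosDef.conjTranspose_mul_self B hB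
  have hA' : (Bᴴ * (1 - (t : ℂ) • (v * vᴴ)) * B).PosDef := hS.conjTranspose_mul_mul_same hB
  set a := (vᴴ * (B * (Bᴴ * B)⁻¹ * Bᴴ) * v) 0 0 with ha
  have hareal : a = (a.re : ℂ) := by
    have h1 : (vᴴ * (B * (Bᴴ * B)⁻¹ * Bᴴ) * v).PosSemidef := by
      apply PosSemidef.conjTranspose_mul_mul_same
      exact hA.inv.posSemidef.mul_mul_conjTranspose_same B
    have h2 := h1.diag_nonneg (i := 0)
    exact Complex.ext (by simp) (by simpa using (Complex.le_def.mp h2).2.symm)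
  have hdet : (Bᴴ * (1 - (t : ℂ) • (v * vᴴ)) * B).det =
      (Bᴴ * B).det * ((1 - t * a.re : ℝ) : ℂ) := by
    have e : Bᴴ * (1 - (t : ℂ) • (v * vᴴ)) * B = Bᴴ * B + (-(t:ℂ) • (Bᴴ * v)) * (vᴴ * B) := by
      rw [Matrix.mul_sub, Matrix.sub_mul, Matrix.mul_one, sub_eq_add_neg, neg_smul,
        Matrix.neg_mul]
      simp only [Matrix.mul_smul, Matrix.smul_mul, Matrix.mul_assoc]
    rw [e, det_add_mul _ _ ((Matrix.isUnit_iff_isUnit_det _).mp hA.isUnit), det_fin_one]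
    congr 1
    rw [Matrix.mul_smul, Matrix.add_apply, Matrix.smul_apply]
    have : vᴴ * B * (Bᴴ * B)⁻¹ * (Bᴴ * v) = vᴴ * (B * (Bᴴ * B)⁻¹ * Bᴴ) * v := by
      simp only [Matrix.mul_assoc]
    rw [this, ← ha]
    conv_lhs => rw [hareal]
    simp
    ring
  have hD := hA.det_pos
  have hD' := hA'.det_pos
  rw [hdet] at hD'
  have hx : 0 < 1 - t * a.re := by
    have h1 : 0 < (Bᴴ * B).det.re := (Complex.lt_def.mp hD).1
    have h2 := (Complex.lt_def.mp hD').1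
    rw [Complex.re_mul_ofReal] at h2
    simp only [Complex.zero_re] at h2
    exact (pos_iff_pos_of_mul_pos h2).mp h1
  rw [hdet, norm_mul, Complex.norm_real, Real.norm_of_nonneg hx.le,
    Real.log_mul (norm_ne_zero_iff.mpr hD.ne') hx.ne']
  have := Real.log_le_sub_one_of_pos hx
  linarith

open Matrix in
lemma aux_near {n : ℕ} {J : Type*} [Fintype J] (d : J → ℕ)
    (M : ∀ j, Matrix (Fin n) (Fin (d j)) ℂ) (hM : ∀ j, Function.Injective (M j).mulVec) (μ : ℝ)
    (hμ : 0 ≤ μ)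
    (hss : ∀ H : Submodule ℂ (Fin n → ℂ),
      ∑ j, (finrank ℂ ↥(LinearMap.range (M j).mulVecLin ⊓ H) : ℝ) ≤ μ * finrank ℂ H)
    (htot : ∑ j, (d j : ℝ) = μ * n) (ε : ℝ) (hε : 0 < ε) :
    ∃ g : Matrix (Fin n) (Fin n) ℂ, IsUnit g ∧ ∀ v : Matrix (Fin n) (Fin 1) ℂ, vᴴ * v = 1 →
      ∑ j, ((vᴴ * ((g * M j) * ((g * M j)ᴴ * (g * M j))⁻¹ * (g * M j)ᴴ) * v) 0 0).re ≤ μ + ε := by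
  classical
  obtain ⟨C, hC⟩ := aux_lower d M hM μ hss htot
  set F : Matrix (Fin n) (Fin n) ℂ → ℝ := fun h =>
    ∑ j, Real.log ‖((M j)ᴴ * h * M j).det‖ - μ * Real.log ‖h.det‖ with hF
  set t : ℝ := ε / (2 * (μ + ε)) with ht
  have ht0 : 0 < t := by positivity
  have ht1 : t < 1 := by rw [ht, div_lt_one (by positivity)]; linarith
  obtain ⟨h, hh, hmin⟩ : ∃ h : Matrix (Fin n) (Fin n) ℂ, h.PosDef ∧
      ∀ h' : Matrix (Fin n) (Fin n) ℂ, h'.PosDef → F h ≤ F h' + t * (ε / 2) := by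
    set S : Set ℝ := F '' {h | h.PosDef} with hS
    have hne : S.Nonempty := ⟨_, 1, PosDef.one, rfl⟩
    have hbd : BddBelow S := ⟨C, by rintro _ ⟨h, hh, rfl⟩; exact hC h hh⟩
    obtain ⟨_, ⟨h, hh, rfl⟩, hlt⟩ := exists_lt_of_csInf_lt hne
      (show sInf S < sInf S + t * (ε / 2) by have : 0 < t * (ε/2) := by positivity
                                             linarith)
    refine ⟨h, hh, fun h' hh' => ?_⟩
    have := csInf_le hbd ⟨h', hh', rfl⟩
    linarith
  obtain ⟨g, hg⟩ : ∃ g : Matrix (Fin n) (Fin n) ℂ, h = gᴴ * g := by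
    open scoped MatrixOrder in
    exact CStarAlgebra.nonneg_iff_eq_star_mul_self.mp
      (Matrix.nonneg_iff_posSemidef.mpr hh.posSemidef)
  have hgu : IsUnit g := by
    rw [Matrix.isUnit_iff_isUnit_det, isUnit_iff_ne_zero]
    intro h0
    have := hh.det_pos.ne'
    rw [hg, det_mul, h0, mul_zero] at this
    exact this rfl
  have hgi : Function.Injective g.mulVec := Matrix.mulVec_injective_iff_isUnit.mpr hgu
  refine ⟨g, hgu, fun v hv => ?_⟩
  set S : Matrix (Fin n) (Fin n) ℂ := 1 - (t : ℂ) • (v * vᴴ) with hS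
  have hSp : S.PosDef := by
    have hK : ((1 - v * vᴴ)ᴴ * (1 - v * vᴴ)) = 1 - v * vᴴ := by
      have : v * vᴴ * (v * vᴴ) = v * vᴴ := by
        rw [Matrix.mul_assoc, ← Matrix.mul_assoc vᴴ, hv, Matrix.one_mul]
      rw [conjTranspose_sub, conjTranspose_one, conjTranspose_mul, conjTranspose_conjTranspose,
        Matrix.sub_mul, Matrix.mul_sub, Matrix.mul_sub, this]
      simp
    have e : S = (1 - t) • (1 : Matrix (Fin n) (Fin n) ℂ) +
        t • ((1 - v * vᴴ)ᴴ * (1 - v * vᴴ)) := by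
      rw [hK, hS, smul_sub, sub_smul, one_smul, Complex.coe_smul]
      abel
    rw [e]
    apply PosDef.add_posSemidef
    · exact PosDef.one.smul (by linarith)
    · exact (posSemidef_conjTranspose_mul_self _).smul ht0.le
  have hh' : (gᴴ * S * g).PosDef := hSp.conjTranspose_mul_mul_same hgi
  have key := hmin _ hh'
  have hdetS : ‖(gᴴ * S * g).det‖ = ‖h.det‖ * (1 - t) := by
    have : S.det = ((1 - t : ℝ) : ℂ) := by
      rw [hS, ← Matrix.smul_mul, det_one_sub_mul_comm, Matrix.mul_smul, hv, det_fin_one]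
      simp
    rw [hg, det_mul, det_mul, det_mul, this, norm_mul, norm_mul, norm_mul, Complex.norm_real,
      Real.norm_of_nonneg (by linarith)]
    ring
  have hlog : Real.log ‖(gᴴ * S * g).det‖ = Real.log ‖h.det‖ + Real.log (1 - t) := by
    rw [hdetS, Real.log_mul (norm_ne_zero_iff.mpr hh.det_pos.ne') (by linarith)]
  have hj : ∀ j, Real.log ‖((M j)ᴴ * (gᴴ * S * g) * M j).det‖ ≤
      Real.log ‖((M j)ᴴ * h * M j).det‖ - t *
      ((vᴴ * ((g * M j) * ((g * M j)ᴴ * (g * M j))⁻¹ * (g * M j)ᴴ) * v) 0 0).re := by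
    intro j
    have hB : Function.Injective (g * M j).mulVec := by
      intro x y hxy
      rw [← Matrix.mulVec_mulVec, ← Matrix.mulVec_mulVec] at hxy
      exact hM j (hgi hxy)
    have := aux_step (g * M j) hB v t hSp
    have e1 : (g * M j)ᴴ * S * (g * M j) = (M j)ᴴ * (gᴴ * S * g) * M j := by
      rw [conjTranspose_mul]; simp only [Matrix.mul_assoc]
    have e2 : (g * M j)ᴴ * (g * M j) = (M j)ᴴ * h * M j := by
      rw [conjTranspose_mul, hg]; simp only [Matrix.mul_assoc]
    rw [e1] at this
    rw [e2] at this ⊢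
    exact this
  have hsum := Finset.sum_le_sum (fun j (_ : j ∈ Finset.univ) => hj j)
  rw [Finset.sum_sub_distrib, ← Finset.mul_sum] at hsum
  simp only [hF] at key
  rw [hlog] at key
  set A := ∑ j, ((vᴴ * ((g * M j) * ((g * M j)ᴴ * (g * M j))⁻¹ * (g * M j)ᴴ) * v) 0 0).re with hA
  have h1 : t * A ≤ t * (ε / 2) - μ * Real.log (1 - t) := by linarith
  have h2 := Real.one_sub_inv_le_log_of_pos (show 0 < 1 - t by linarith)
  have h3 : - Real.log (1 - t) ≤ t * (1 - t)⁻¹ := by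
    have : (1 - t) * (1 - t)⁻¹ = 1 := mul_inv_cancel₀ (by linarith)
    nlinarith
  have h4 : t * A ≤ t * (ε / 2 + μ * (1 - t)⁻¹) := by
    have := mul_le_mul_of_nonneg_left h3 hμ
    nlinarith
  have h5 : A ≤ ε / 2 + μ * (1 - t)⁻¹ := le_of_mul_le_mul_left h4 ht0
  have h6 : μ * (1 - t)⁻¹ ≤ μ + ε / 2 := by
    rw [← div_eq_mul_inv, div_le_iff₀ (by linarith), ht]
    have : (μ + ε / 2) * (1 - ε / (2 * (μ + ε))) = (μ + ε/2) * (2 * μ + ε) / (2 * (μ + ε)) := by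
      field_simp; ring
    rw [this, le_div_iff₀ (by positivity)]
    nlinarith [sq_nonneg ε]
  linarith


open Matrix in
lemma aux_proj {n d : ℕ} (B : Matrix (Fin n) (Fin d) ℂ) (hB : Function.Injective B.mulVec)
    (K : Submodule ℂ (EuclideanSpace ℂ (Fin n)))
    (hK : ∀ x, x ∈ K ↔ ∃ y, WithLp.toLp 2 (B *ᵥ y) = x) (x : EuclideanSpace ℂ (Fin n)) :
    K.starProjection x = WithLp.toLp 2 ((B * (Bᴴ * B)⁻¹ * Bᴴ) *ᵥ (WithLp.ofLp x)) := by
  have hA : (Bᴴ * B).PosDef := PosDef.conjTranspose_mul_self B hB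
  have hA' : IsUnit (Bᴴ * B).det := (Matrix.isUnit_iff_isUnit_det _).mp hA.isUnit
  apply Submodule.eq_starProjection_of_mem_of_inner_eq_zero
  · rw [hK]
    exact ⟨((Bᴴ * B)⁻¹ * Bᴴ) *ᵥ (WithLp.ofLp x), by rw [Matrix.mulVec_mulVec, Matrix.mul_assoc]⟩
  · intro w hw
    obtain ⟨y, rfl⟩ := (hK w).mp hw
    rw [EuclideanSpace.inner_eq_star_dotProduct]
    simp only [WithLp.ofLp_sub]
    rw [star_sub, dotProduct_sub, sub_eq_zero]
    have h1 : ∀ z : Fin n → ℂ, (B *ᵥ y) ⬝ᵥ star z = star ((Bᴴ *ᵥ z)) ⬝ᵥ y := by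
      intro z
      rw [star_mulVec, conjTranspose_conjTranspose, ← dotProduct_mulVec, dotProduct_comm]
    rw [h1, h1, Matrix.mulVec_mulVec, ← Matrix.mul_assoc, ← Matrix.mul_assoc,
      Matrix.mul_nonsing_inv _ hA', Matrix.one_mul]

open Matrix in
lemma aux_good {V : Type*} [AddCommGroup V] [Module ℂ V] [FiniteDimensional ℂ V]
    {J : Type*} [Fintype J] (U : J → Submodule ℂ V) (μ : ℝ) (hμ : 0 ≤ μ)
    (hss : ∀ H : Submodule ℂ V, ∑ j, (finrank ℂ ↥(U j ⊓ H) : ℝ) ≤ μ * finrank ℂ H)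
    (htot : ∑ j, (finrank ℂ (U j) : ℝ) = μ * finrank ℂ V) (ε : ℝ) (hε : 0 < ε) :
    ∃ φ : V ≃ₗ[ℂ] EuclideanSpace ℂ (Fin (finrank ℂ V)), ∀ x : EuclideanSpace ℂ (Fin (finrank ℂ V)),
      ∑ j, ‖((U j).map φ.toLinearMap).starProjection x‖ ^ 2 ≤ (μ + ε) * ‖x‖ ^ 2 := by
  classical
  set n := finrank ℂ V with hn
  set e : V ≃ₗ[ℂ] (Fin n → ℂ) := (finBasis ℂ V).equivFun with he
  set L : ∀ j, (Fin (finrank ℂ (U j)) → ℂ) →ₗ[ℂ] (Fin n → ℂ) := fun j =>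
    e.toLinearMap ∘ₗ (U j).subtype ∘ₗ (finBasis ℂ (U j)).equivFun.symm.toLinearMap with hL
  set M : ∀ j, Matrix (Fin n) (Fin (finrank ℂ (U j))) ℂ := fun j => LinearMap.toMatrix' (L j) with hM
  have hML : ∀ j, (M j).mulVecLin = L j := fun j => by
    rw [← Matrix.toLin'_apply', hM]; exact Matrix.toLin'_toMatrix' _
  have hMv : ∀ j y, M j *ᵥ y = L j y := fun j y => by rw [← hML]; rfl
  have hLi : ∀ j, Function.Injective (L j) := fun j => by
    intro x y hxy
    exact (finBasis ℂ (U j)).equivFun.symm.injective (Subtype.val_injective (e.injective hxy))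
  have hLr : ∀ j, LinearMap.range (L j) = (U j).map e.toLinearMap := fun j => by
    rw [hL]
    simp only
    rw [LinearMap.range_comp, LinearMap.range_comp, LinearEquiv.range, Submodule.map_top,
      Submodule.range_subtype]
  obtain ⟨g, hgu, hg⟩ := aux_near (fun j => finrank ℂ (U j)) M
    (fun j x y hxy => hLi j (by simpa only [hMv] using hxy)) μ hμ
    (fun H => by
      have h1 := hss (H.map e.symm.toLinearMap)
      rw [LinearEquiv.finrank_map_eq] at h1
      refine le_trans (le_of_eq ?_) h1
      refine Finset.sum_congr rfl fun j _ => ?_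
      rw [hML, hLr]
      have : (U j).map e.toLinearMap ⊓ H = (U j ⊓ H.map e.symm.toLinearMap).map e.toLinearMap := by
        ext x
        simp only [Submodule.mem_inf, Submodule.mem_map]
        constructor
        · rintro ⟨⟨y, hy, rfl⟩, hx⟩
          exact ⟨y, ⟨hy, _, hx, by simp⟩, rfl⟩
        · rintro ⟨y, ⟨hy, z, hz, rfl⟩, rfl⟩
          exact ⟨⟨_, hy, rfl⟩, by simpa using hz⟩
      rw [this, LinearEquiv.finrank_map_eq]) htot ε hε
  have hgi : Function.Injective g.mulVec := Matrix.mulVec_injective_iff_isUnit.mpr hgu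
  set G : (Fin n → ℂ) ≃ₗ[ℂ] (Fin n → ℂ) := LinearEquiv.ofInjectiveEndo g.mulVecLin hgi with hG
  have hGa : ∀ x, G x = g *ᵥ x := fun x => rfl
  refine ⟨e ≪≫ₗ G ≪≫ₗ (WithLp.linearEquiv 2 ℂ (Fin n → ℂ)).symm, ?_⟩
  set φ := e ≪≫ₗ G ≪≫ₗ (WithLp.linearEquiv 2 ℂ (Fin n → ℂ)).symm with hφ
  have hunit : ∀ x : EuclideanSpace ℂ (Fin n), ‖x‖ = 1 →
      ∑ j, ‖((U j).map φ.toLinearMap).starProjection x‖ ^ 2 ≤ μ + ε := by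
    intro x hx
    have hv : (replicateCol (Fin 1) (WithLp.ofLp x))ᴴ * replicateCol (Fin 1) (WithLp.ofLp x) = 1 := by
      ext i k
      have h1 : inner ℂ x x = (1:ℂ) := by rw [inner_self_eq_norm_sq_to_K, hx]; simp
      rw [EuclideanSpace.inner_eq_star_dotProduct, dotProduct_comm] at h1
      rw [Subsingleton.elim i k, Matrix.one_apply_eq, ← h1]
      rfl
    refine le_trans (le_of_eq ?_) (hg _ hv)
    refine Finset.sum_congr rfl fun j _ => ?_
    have hB : Function.Injective (g * M j).mulVec := by
      intro x y hxy
      rw [← Matrix.mulVec_mulVec, ← Matrix.mulVec_mulVec] at hxy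
      exact hLi j (by simpa only [hMv] using hgi hxy)
    have hp := aux_proj (g * M j) hB ((U j).map φ.toLinearMap) (fun z => by
      have hr : ∀ w, w ∈ (U j).map e.toLinearMap ↔ ∃ y, L j y = w := fun w => by
        rw [← hLr]; rfl
      constructor
      · rintro ⟨u, hu, rfl⟩
        obtain ⟨y, hy⟩ := (hr (e u)).mp ⟨u, hu, rfl⟩
        refine ⟨y, ?_⟩
        rw [← Matrix.mulVec_mulVec, hMv, hy]
        rfl
      · rintro ⟨y, rfl⟩
        obtain ⟨u, hu, hy⟩ := (hr (L j y)).mpr ⟨y, rfl⟩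
        refine ⟨u, hu, ?_⟩
        rw [← Matrix.mulVec_mulVec, hMv, ← hy]
        rfl) x
    have h2 : ‖((U j).map φ.toLinearMap).starProjection x‖ ^ 2 =
        (inner ℂ x (((U j).map φ.toLinearMap).starProjection x)).re := by
      set K := (U j).map φ.toLinearMap with hKdef
      have h3 : K.starProjection (K.starProjection x) = K.starProjection x :=
        Submodule.starProjection_eq_self_iff.mpr (Submodule.starProjection_apply_mem K x)
      rw [← h3, ← Submodule.inner_starProjection_left_eq_right, h3]
      rw [inner_self_eq_norm_sq_to_K]
      norm_cast
    rw [h2, hp, EuclideanSpace.inner_eq_star_dotProduct, dotProduct_comm, Matrix.mul_assoc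
      (replicateCol (Fin 1) (WithLp.ofLp x))ᴴ]
    rfl
  intro x
  by_cases hx : x = 0
  · subst hx; simp
  have hx0 : 0 < ‖x‖ := norm_pos_iff.mpr hx
  have h1 := hunit (((‖x‖⁻¹ : ℝ) : ℂ) • x) (by
    rw [norm_smul, Complex.norm_real, norm_inv, norm_norm, inv_mul_cancel₀ hx0.ne'])
  simp only [map_smul, norm_smul, Complex.norm_real, norm_inv, norm_norm, mul_pow] at h1
  rw [← Finset.mul_sum, inv_pow, inv_mul_le_iff₀ (by positivity)] at h1
  linarith


lemma aux_dim {E : Type*} [NormedAddCommGroup E] [InnerProductSpace ℂ E] [FiniteDimensional ℂ E]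
    (R : E →ₗ[ℂ] E) (hs : R.IsSymmetric) (hi : ∀ x, R (R x) = R x) (T H : Submodule ℂ E)
    (hT : ∀ x ∈ T, R x = x) {ι : Type*} [Fintype ι] (b : OrthonormalBasis ι ℂ H) :
    (finrank ℂ ↥(T ⊓ H) : ℝ) ≤ ∑ i, (inner ℂ (b i : E) (R (b i : E))).re := by
  set c := stdOrthonormalBasis ℂ ↥(T ⊓ H) with hc
  have h1 : ∀ x : E, (inner ℂ x (R x)).re = ‖R x‖ ^ 2 := by
    intro x
    rw [← hi x, ← hs, hi, inner_self_eq_norm_sq_to_K]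
    norm_cast
  have hcon : Orthonormal ℂ (fun k => (c k : E)) :=
    c.orthonormal.comp_linearIsometry (T ⊓ H).subtypeₗᵢ
  have h2 : ∀ i, ∑ k, ‖inner ℂ (c k : E) (b i : E)‖ ^ 2 ≤ (inner ℂ (b i : E) (R (b i : E))).re := by
    intro i
    rw [h1]
    refine le_trans (le_of_eq ?_) (hcon.sum_inner_products_le (R (b i : E)) (s := Finset.univ))
    refine Finset.sum_congr rfl fun k _ => ?_
    rw [← hs, hT _ (c k).2.1]
  refine le_trans ?_ (Finset.sum_le_sum fun i _ => h2 i)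
  rw [Finset.sum_comm]
  have h3 : ∀ k, ∑ i, ‖inner ℂ (c k : E) (b i : E)‖ ^ 2 = 1 := by
    intro k
    have := b.sum_sq_norm_inner_left (⟨(c k : E), (c k).2.2⟩ : H)
    rw [show ‖(⟨(c k : E), (c k).2.2⟩ : H)‖ = 1 from c.orthonormal.1 k] at this
    simpa using this
  simp [h3]

lemma aux_grade {E : Type*} [NormedAddCommGroup E] [InnerProductSpace ℂ E]
    [FiniteDimensional ℂ E] (C : ℕ → Submodule ℂ E) (h0 : C 0 = ⊤) (hC : Antitone C)
    (N : ℕ) (hN : C N = ⊥) :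
    ∃ e : ℕ → (E →ₗ[ℂ] E), (∀ p, (e p).IsSymmetric) ∧ (∀ p x, e p x ∈ C p) ∧
      (∀ p p' x, x ∈ C p → p' < p → e p' x = 0) ∧ ∑ p ∈ Finset.range N, e p = LinearMap.id ∧
      ∑ p ∈ Finset.range N, p • e p =
        ∑ l ∈ Finset.Icc 1 N, ((C l).starProjection : E →ₗ[ℂ] E) := by
  set P : ℕ → (E →ₗ[ℂ] E) := fun p => ((C p).starProjection : E →ₗ[ℂ] E) with hP
  have hPx : ∀ p x, x ∈ C p → P p x = x := fun p x hx =>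
    Submodule.starProjection_eq_self_iff.mpr hx
  have hPm : ∀ p x, P p x ∈ C p := fun p x => Submodule.starProjection_apply_mem _ x
  have hPN : P N = 0 := by
    ext x
    have := hPm N x
    rw [hN] at this
    simpa using this
  have hP0 : P 0 = LinearMap.id := by
    ext x
    exact hPx 0 x (by rw [h0]; trivial)
  refine ⟨fun p => P p - P (p + 1), fun p => ?_, fun p x => ?_, fun p p' x hx hp => ?_, ?_, ?_⟩
  · exact (Submodule.starProjection_isSymmetric (K := C p)).sub
      (Submodule.starProjection_isSymmetric (K := C (p + 1)))
  · exact (C p).sub_mem (hPm p x) (hC (Nat.le_succ p) (hPm (p + 1) x))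
  · rw [LinearMap.sub_apply, hPx _ _ (hC hp.le hx), hPx _ _ (hC hp hx), sub_self]
  · rw [Finset.sum_range_sub', hP0, hPN, sub_zero]
  · have : ∀ n, ∑ p ∈ Finset.range n, p • (P p - P (p + 1)) + n • P n = ∑ l ∈ Finset.Icc 1 n, P l := by
      intro n
      induction n with
      | zero => simp
      | succ n ih =>
        rw [Finset.sum_range_succ, Finset.sum_Icc_succ_top (by omega), ← ih, smul_sub, succ_nsmul]
        abel
    rw [← this, hPN, smul_zero, add_zero]

lemma aux_sqrt {E : Type*} [NormedAddCommGroup E] [InnerProductSpace ℂ E]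
    [FiniteDimensional ℂ E] (T : E →ₗ[ℂ] E) (hT : T.IsPositive) :
    ∃ D : E →ₗ[ℂ] E, T = LinearMap.adjoint D ∘ₗ D := by
  have : CompleteSpace E := FiniteDimensional.complete ℂ E
  have h0 : 0 ≤ LinearMap.toContinuousLinearMap T := by
    rw [ContinuousLinearMap.nonneg_iff_isPositive]
    exact (LinearMap.isPositive_toContinuousLinearMap_iff T).mpr hT
  obtain ⟨D, hD⟩ := CStarAlgebra.nonneg_iff_eq_star_mul_self.mp h0
  refine ⟨D, ?_⟩
  apply LinearMap.ext
  intro x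
  apply ext_inner_left ℂ
  intro y
  rw [LinearMap.comp_apply, LinearMap.adjoint_inner_right]
  have := congrArg (fun g => inner ℂ y (g x)) hD
  simp only [LinearMap.coe_toContinuousLinearMap', mul_apply_eq_comp,
    ContinuousLinearMap.star_eq_adjoint, ContinuousLinearMap.adjoint_inner_right] at this
  exact this

lemma aux_pos {E F : Type*} [NormedAddCommGroup E] [InnerProductSpace ℂ E]
    [FiniteDimensional ℂ E] [NormedAddCommGroup F] [InnerProductSpace ℂ F] [FiniteDimensional ℂ F]
    (T : E →ₗ[ℂ] E) (hT : T.IsPositive) (x : E ⊗[ℂ] F) :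
    0 ≤ (inner ℂ x (TensorProduct.map T LinearMap.id x)).re := by
  obtain ⟨D, hD⟩ : ∃ D : E →ₗ[ℂ] E, T = LinearMap.adjoint D ∘ₗ D := aux_sqrt T hT
  have : TensorProduct.map T (LinearMap.id : F →ₗ[ℂ] F) =
      LinearMap.adjoint (TensorProduct.map D (LinearMap.id : F →ₗ[ℂ] F)) ∘ₗ
        TensorProduct.map D (LinearMap.id : F →ₗ[ℂ] F) := by
    rw [TensorProduct.adjoint_map, ← TensorProduct.map_comp, hD]
    simp
  rw [this, LinearMap.comp_apply, LinearMap.adjoint_inner_right]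
  exact inner_self_nonneg (𝕜 := ℂ)

lemma aux_pos' {E F : Type*} [NormedAddCommGroup E] [InnerProductSpace ℂ E]
    [FiniteDimensional ℂ E] [NormedAddCommGroup F] [InnerProductSpace ℂ F] [FiniteDimensional ℂ F]
    (T : F →ₗ[ℂ] F) (hT : T.IsPositive) (x : E ⊗[ℂ] F) :
    0 ≤ (inner ℂ x (TensorProduct.map LinearMap.id T x)).re := by
  obtain ⟨D, hD⟩ : ∃ D : F →ₗ[ℂ] F, T = LinearMap.adjoint D ∘ₗ D := aux_sqrt T hT
  have : TensorProduct.map (LinearMap.id : E →ₗ[ℂ] E) T =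
      LinearMap.adjoint (TensorProduct.map (LinearMap.id : E →ₗ[ℂ] E) D) ∘ₗ
        TensorProduct.map (LinearMap.id : E →ₗ[ℂ] E) D := by
    rw [TensorProduct.adjoint_map, ← TensorProduct.map_comp, hD]
    simp
  rw [this, LinearMap.comp_apply, LinearMap.adjoint_inner_right]
  exact inner_self_nonneg (𝕜 := ℂ)

lemma aux_tensor {E F : Type*} [NormedAddCommGroup E] [InnerProductSpace ℂ E]
    [FiniteDimensional ℂ E] [NormedAddCommGroup F] [InnerProductSpace ℂ F] [FiniteDimensional ℂ F]
    (A : ℕ → Submodule ℂ E) (B : ℕ → Submodule ℂ F) (hA0 : A 0 = ⊤) (hB0 : B 0 = ⊤)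
    (hA : Antitone A) (hB : Antitone B) (N : ℕ) (hAN : A N = ⊥) (hBN : B N = ⊥) :
    ∃ R : ℕ → (E ⊗[ℂ] F →ₗ[ℂ] E ⊗[ℂ] F), (∀ l, (R l).IsSymmetric) ∧
      (∀ l, LinearMap.IsProj (⨆ (p : ℕ) (q : ℕ) (_ : p + q = l), prodSub (A p) (B q)) (R l)) ∧
      ∑ l ∈ Finset.Icc 1 (2 * N), R l =
        TensorProduct.map (∑ l ∈ Finset.Icc 1 N, ((A l).starProjection : E →ₗ[ℂ] E)) LinearMap.id +
        TensorProduct.map LinearMap.id (∑ l ∈ Finset.Icc 1 N, ((B l).starProjection : F →ₗ[ℂ] F)) := by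
  classical
  obtain ⟨e, e1, e2, e3, e4, e5⟩ := aux_grade A hA0 hA N hAN
  obtain ⟨f, f1, f2, f3, f4, f5⟩ := aux_grade B hB0 hB N hBN
  have mem : ∀ l p q (x : E) (y : F), x ∈ A p → y ∈ B q → l ≤ p + q →
      x ⊗ₜ[ℂ] y ∈ (⨆ (p : ℕ) (q : ℕ) (_ : p + q = l), prodSub (A p) (B q)) := by
    intro l p q x y hx hy hl
    obtain ⟨p', q', hp, hq, hpq⟩ : ∃ p' q', p' ≤ p ∧ q' ≤ q ∧ p' + q' = l :=
      ⟨min p l, l - min p l, by omega, by omega, by omega⟩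
    refine Submodule.mem_iSup_of_mem p' (Submodule.mem_iSup_of_mem q'
      (Submodule.mem_iSup_of_mem hpq ?_))
    exact ⟨(⟨x, hA hp hx⟩ : A p') ⊗ₜ[ℂ] (⟨y, hB hq hy⟩ : B q'), by simp⟩
  refine ⟨fun l => ∑ p ∈ Finset.range N, ∑ q ∈ Finset.range N,
    if l ≤ p + q then TensorProduct.map (e p) (f q) else 0, fun l => ?_, fun l => ?_, ?_⟩
  · rw [LinearMap.isSymmetric_iff_isSelfAdjoint]
    refine isSelfAdjoint_sum _ fun p _ => isSelfAdjoint_sum _ fun q _ => ?_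
    split_ifs
    · rw [LinearMap.isSelfAdjoint_iff', TensorProduct.adjoint_map,
        LinearMap.isSelfAdjoint_iff'.mp ((LinearMap.isSymmetric_iff_isSelfAdjoint _).mp (e1 p)),
        LinearMap.isSelfAdjoint_iff'.mp ((LinearMap.isSymmetric_iff_isSelfAdjoint _).mp (f1 q))]
    · exact IsSelfAdjoint.zero _
  · constructor
    · intro x
      simp only [LinearMap.sum_apply]
      refine Submodule.sum_mem _ fun p _ => Submodule.sum_mem _ fun q _ => ?_
      split_ifs with h
      · induction x with
        | zero => simp
        | tmul x y => exact mem l p q _ _ (e2 p x) (f2 q y) h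
        | add x y hx hy => rw [map_add]; exact Submodule.add_mem _ hx hy
      · simp
    · intro x hx
      set R := ∑ p ∈ Finset.range N, ∑ q ∈ Finset.range N,
        if l ≤ p + q then TensorProduct.map (e p) (f q) else 0 with hR
      suffices h : (⨆ (p : ℕ) (q : ℕ) (_ : p + q = l), prodSub (A p) (B q)) ≤
          LinearMap.eqLocus R LinearMap.id from h hx
      refine iSup_le fun p => iSup_le fun q => iSup_le fun hpq => ?_
      rintro _ ⟨z, rfl⟩
      rw [LinearMap.mem_eqLocus, LinearMap.id_apply]
      induction z with
      | zero => simp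
      | add x y hx hy => rw [map_add, map_add, hx, hy]
      | tmul x y =>
        rw [TensorProduct.map_tmul]
        simp only [Submodule.subtype_apply]
        have hx := congrArg (fun g => g (x : E)) e4
        have hy := congrArg (fun g => g (y : F)) f4
        simp only [LinearMap.sum_apply, LinearMap.id_apply] at hx hy
        conv_rhs => rw [← hx, ← hy, TensorProduct.sum_tmul]
        rw [hR]
        simp only [LinearMap.sum_apply]
        refine Finset.sum_congr rfl fun p' _ => ?_
        rw [TensorProduct.tmul_sum]
        refine Finset.sum_congr rfl fun q' _ => ?_
        split_ifs with h
        · rfl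
        · rcases (show p' < p ∨ q' < q by omega) with h | h
          · rw [e3 p p' x x.2 h]; simp
          · rw [f3 q q' y y.2 h]; simp
  · rw [Finset.sum_comm]
    have h1 : ∀ p ∈ Finset.range N, ∑ l ∈ Finset.Icc 1 (2 * N), ∑ q ∈ Finset.range N,
        (if l ≤ p + q then TensorProduct.map (e p) (f q) else 0) =
        ∑ q ∈ Finset.range N, (TensorProduct.map (p • e p) (f q) +
          TensorProduct.map (e p) (q • f q)) := by
      intro p hp
      rw [Finset.sum_comm]
      refine Finset.sum_congr rfl fun q hq => ?_
      rw [← Finset.sum_filter, Finset.sum_const]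
      have : (Finset.Icc 1 (2 * N)).filter (fun l => l ≤ p + q) = Finset.Icc 1 (p + q) := by
        ext l
        simp only [Finset.mem_filter, Finset.mem_Icc, Finset.mem_range] at *
        omega
      rw [this, Nat.card_Icc]
      apply TensorProduct.ext'
      intro x y
      simp [add_smul, TensorProduct.smul_tmul']
    rw [Finset.sum_congr rfl h1, ← e5, ← f5]
    rw [← e4, ← f4]
    apply TensorProduct.ext'
    intro x y
    simp only [LinearMap.sum_apply, LinearMap.add_apply, TensorProduct.map_tmul,
      Finset.sum_add_distrib, TensorProduct.sum_tmul, TensorProduct.tmul_sum]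
    congr 1 <;> exact Finset.sum_comm


lemma aux_symm_pos {E : Type*} [NormedAddCommGroup E] [InnerProductSpace ℂ E]
    [FiniteDimensional ℂ E] {m : ℕ} (N : ℕ) (A : Fin m → ℕ → Submodule ℂ E) (c : ℝ)
    (h : ∀ x, ∑ s, ∑ l ∈ Finset.Icc 1 N, ‖(A s l).starProjection x‖ ^ 2 ≤ c * ‖x‖ ^ 2) :
    ((c : ℂ) • (LinearMap.id : E →ₗ[ℂ] E) -
      ∑ s, ∑ l ∈ Finset.Icc 1 N, ((A s l).starProjection : E →ₗ[ℂ] E)).IsPositive := by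
  have hs : ∀ K : Submodule ℂ E, ((K.starProjection : E →ₗ[ℂ] E)).IsSymmetric := fun K =>
    Submodule.starProjection_isSymmetric (K := K)
  refine ⟨?_, ?_⟩
  · refine LinearMap.IsSymmetric.sub ?_ ?_
    · exact LinearMap.IsSymmetric.smul (by simp) LinearMap.IsSymmetric.id
    · rw [LinearMap.isSymmetric_iff_isSelfAdjoint]
      refine isSelfAdjoint_sum _ fun s _ => isSelfAdjoint_sum _ fun l _ => ?_
      exact (LinearMap.isSymmetric_iff_isSelfAdjoint _).mp (hs _)
  · intro x
    have h2 : ∀ K : Submodule ℂ E, (inner ℂ (K.starProjection x) x).re = ‖K.starProjection x‖ ^ 2 := by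
      intro K
      have h3 : K.starProjection (K.starProjection x) = K.starProjection x :=
        Submodule.starProjection_eq_self_iff.mpr (Submodule.starProjection_apply_mem K x)
      rw [← h3, Submodule.inner_starProjection_left_eq_right, h3, inner_self_eq_norm_sq_to_K]
      norm_cast
    have h4 : (inner ℂ x x).re = ‖x‖ ^ 2 := by
      rw [inner_self_eq_norm_sq_to_K]; norm_cast
    have := h x
    simp only [LinearMap.sub_apply, LinearMap.smul_apply, LinearMap.id_apply, LinearMap.sum_apply,
      inner_sub_left, inner_smul_left, sum_inner, Complex.conj_ofReal, RCLike.re_to_complex,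
      Complex.sub_re, Complex.re_ofReal_mul, Complex.re_sum, ContinuousLinearMap.coe_coe, h2, h4]
    linarith

lemma aux_comb {G : Type*} [NormedAddCommGroup G] [InnerProductSpace ℂ G] (x : G) (hx : ‖x‖ = 1)
    (S X Y : G →ₗ[ℂ] G) (c c' : ℝ) (hS : S = X + Y)
    (p1 : 0 ≤ (inner ℂ x (((c : ℂ) • (LinearMap.id : G →ₗ[ℂ] G) - X) x)).re)
    (p2 : 0 ≤ (inner ℂ x (((c' : ℂ) • (LinearMap.id : G →ₗ[ℂ] G) - Y) x)).re) :
    (inner ℂ x (S x)).re ≤ c + c' := by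
  have hn : inner ℂ x x = (1 : ℂ) := by
    rw [inner_self_eq_norm_sq_to_K, hx]; simp
  rw [LinearMap.sub_apply, LinearMap.smul_apply, LinearMap.id_apply, inner_sub_right,
    inner_smul_right, hn, Complex.sub_re] at p1 p2
  rw [hS, LinearMap.add_apply, inner_add_right, Complex.add_re]
  simp only [mul_one, Complex.ofReal_re] at p1 p2
  linarith

lemma aux_trace {G : Type*} [NormedAddCommGroup G] [InnerProductSpace ℂ G] [FiniteDimensional ℂ G]
    (K : Submodule ℂ G) :
    LinearMap.trace ℂ G (K.starProjection : G →ₗ[ℂ] G) = finrank ℂ K := by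
  have : LinearMap.IsProj K (K.starProjection : G →ₗ[ℂ] G) :=
    ⟨fun x => Submodule.starProjection_apply_mem K x,
      fun x hx => Submodule.starProjection_eq_self_iff.mpr hx⟩
  exact this.trace

lemma aux_ineq {E F : Type*} [NormedAddCommGroup E] [InnerProductSpace ℂ E]
    [FiniteDimensional ℂ E] [NormedAddCommGroup F] [InnerProductSpace ℂ F] [FiniteDimensional ℂ F]
    {m : ℕ} (N : ℕ) (A : Fin m → ℕ → Submodule ℂ E) (B : Fin m → ℕ → Submodule ℂ F)
    (hA0 : ∀ s, A s 0 = ⊤) (hB0 : ∀ s, B s 0 = ⊤)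
    (hA : ∀ s, Antitone (A s)) (hB : ∀ s, Antitone (B s))
    (hAN : ∀ s, A s N = ⊥) (hBN : ∀ s, B s N = ⊥) (c c' : ℝ)
    (h : ∀ x, ∑ s, ∑ l ∈ Finset.Icc 1 N, ‖(A s l).starProjection x‖ ^ 2 ≤ c * ‖x‖ ^ 2)
    (h' : ∀ x, ∑ s, ∑ l ∈ Finset.Icc 1 N, ‖(B s l).starProjection x‖ ^ 2 ≤ c' * ‖x‖ ^ 2)
    (H : Submodule ℂ (E ⊗[ℂ] F)) :
    ∑ s, ∑ l ∈ Finset.Icc 1 (2 * N), (finrank ℂ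
      ↥((⨆ (p : ℕ) (q : ℕ) (_ : p + q = l), prodSub (A s p) (B s q)) ⊓ H) : ℝ) ≤
      (c + c') * finrank ℂ H := by
  choose R hRs hRp hR using fun s => aux_tensor (A s) (B s) (hA0 s) (hB0 s) (hA s) (hB s) N
    (hAN s) (hBN s)
  set b := stdOrthonormalBasis ℂ H with hb
  have h1 : ∀ s l, (finrank ℂ
      ↥((⨆ (p : ℕ) (q : ℕ) (_ : p + q = l), prodSub (A s p) (B s q)) ⊓ H) : ℝ) ≤
      ∑ i, (inner ℂ (b i : E ⊗[ℂ] F) (R s l (b i : E ⊗[ℂ] F))).re := fun s l =>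
    aux_dim (R s l) (hRs s l) (fun x => (hRp s l).map_id _ ((hRp s l).map_mem x)) _ H
      (fun x hx => (hRp s l).map_id x hx) b
  refine le_trans (Finset.sum_le_sum fun s _ => Finset.sum_le_sum fun l _ => h1 s l) ?_
  have h2 : ∑ s, ∑ l ∈ Finset.Icc 1 (2 * N),
      ∑ i, (inner ℂ (b i : E ⊗[ℂ] F) (R s l (b i : E ⊗[ℂ] F))).re =
      ∑ i, (inner ℂ (b i : E ⊗[ℂ] F) ((∑ s, ∑ l ∈ Finset.Icc 1 (2 * N), R s l)
        (b i : E ⊗[ℂ] F))).re := by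
    simp only [LinearMap.sum_apply, inner_sum, Complex.re_sum]
    conv_rhs => rw [Finset.sum_comm]
    refine Finset.sum_congr rfl fun s _ => ?_
    rw [Finset.sum_comm]
  rw [h2]
  have h3 : ∀ i, (inner ℂ (b i : E ⊗[ℂ] F) ((∑ s, ∑ l ∈ Finset.Icc 1 (2 * N), R s l)
        (b i : E ⊗[ℂ] F))).re ≤ c + c' := by
    intro i
    have p1 := aux_pos (F := F) _ (aux_symm_pos N A c h) (b i : E ⊗[ℂ] F)
    have p2 := aux_pos' (E := E) _ (aux_symm_pos N B c' h') (b i : E ⊗[ℂ] F)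
    have e : ∑ s, ∑ l ∈ Finset.Icc 1 (2 * N), R s l =
        TensorProduct.map (∑ s, ∑ l ∈ Finset.Icc 1 N, ((A s l).starProjection : E →ₗ[ℂ] E))
          LinearMap.id + TensorProduct.map LinearMap.id
          (∑ s, ∑ l ∈ Finset.Icc 1 N, ((B s l).starProjection : F →ₗ[ℂ] F)) := by
      rw [Finset.sum_congr rfl fun s _ => hR s, Finset.sum_add_distrib]
      congr 1
      · exact (map_sum ((TensorProduct.mapBilinear (RingHom.id ℂ) E F E F).flip LinearMap.id) _ _).symm
      · exact (map_sum (TensorProduct.mapBilinear (RingHom.id ℂ) E F E F LinearMap.id) _ _).symm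
    have q1 : ∀ X : E →ₗ[ℂ] E, TensorProduct.map ((c : ℂ) • (LinearMap.id : E →ₗ[ℂ] E) - X)
        (LinearMap.id : F →ₗ[ℂ] F) = (c : ℂ) • LinearMap.id - TensorProduct.map X LinearMap.id := by
      intro X
      apply TensorProduct.ext'
      intro x y
      simp only [TensorProduct.map_tmul, LinearMap.sub_apply, LinearMap.smul_apply,
        LinearMap.id_apply, TensorProduct.sub_tmul, TensorProduct.smul_tmul']
    have q2 : ∀ X : F →ₗ[ℂ] F, TensorProduct.map (LinearMap.id : E →ₗ[ℂ] E)
        ((c' : ℂ) • (LinearMap.id : F →ₗ[ℂ] F) - X) =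
        (c' : ℂ) • LinearMap.id - TensorProduct.map LinearMap.id X := by
      intro X
      apply TensorProduct.ext'
      intro x y
      simp only [TensorProduct.map_tmul, LinearMap.sub_apply, LinearMap.smul_apply,
        LinearMap.id_apply, TensorProduct.tmul_sub, TensorProduct.tmul_smul]
    rw [q1] at p1
    rw [q2] at p2
    exact aux_comb (b i : E ⊗[ℂ] F) (b.orthonormal.1 i) _ _ _ c c' e p1 p2
  refine le_trans (Finset.sum_le_sum fun i _ => h3 i) (le_of_eq ?_)
  rw [Finset.sum_const, Finset.card_univ, Fintype.card_fin, nsmul_eq_mul, mul_comm]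

lemma aux_total {E F : Type*} [NormedAddCommGroup E] [InnerProductSpace ℂ E]
    [FiniteDimensional ℂ E] [NormedAddCommGroup F] [InnerProductSpace ℂ F] [FiniteDimensional ℂ F]
    (A : ℕ → Submodule ℂ E) (B : ℕ → Submodule ℂ F) (hA0 : A 0 = ⊤) (hB0 : B 0 = ⊤)
    (hA : Antitone A) (hB : Antitone B) (N : ℕ) (hAN : A N = ⊥) (hBN : B N = ⊥) :
    ∑ l ∈ Finset.Icc 1 (2 * N), finrank ℂ
      ↥(⨆ (p : ℕ) (q : ℕ) (_ : p + q = l), prodSub (A p) (B q)) =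
      (∑ l ∈ Finset.Icc 1 N, finrank ℂ (A l)) * finrank ℂ F +
      finrank ℂ E * (∑ l ∈ Finset.Icc 1 N, finrank ℂ (B l)) := by
  obtain ⟨R, hRs, hRp, hR⟩ := aux_tensor A B hA0 hB0 hA hB N hAN hBN
  have := congrArg (LinearMap.trace ℂ (E ⊗[ℂ] F)) hR
  rw [map_sum, map_add, LinearMap.trace_tensorProduct', LinearMap.trace_tensorProduct', map_sum,
    map_sum, LinearMap.trace_id, LinearMap.trace_id] at this
  rw [Finset.sum_congr rfl fun l _ => (hRp l).trace,
    Finset.sum_congr rfl fun l _ => aux_trace (A l),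
    Finset.sum_congr rfl fun l _ => aux_trace (B l)] at this
  exact_mod_cast this

lemma aux_good' {V : Type*} [AddCommGroup V] [Module ℂ V] [FiniteDimensional ℂ V] [Nontrivial V]
    {m : ℕ} (N : ℕ) (Vf : Fin m → ℕ → Submodule ℂ V) (hss : MFiltSemistable m N Vf)
    (ε : ℝ) (hε : 0 < ε) :
    ∃ φ : V ≃ₗ[ℂ] EuclideanSpace ℂ (Fin (finrank ℂ V)), ∀ x : EuclideanSpace ℂ (Fin (finrank ℂ V)),
      ∑ s, ∑ l ∈ Finset.Icc 1 N, ‖((Vf s l).map φ.toLinearMap).starProjection x‖ ^ 2 ≤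
        ((∑ s, ∑ l ∈ Finset.Icc 1 N, (finrank ℂ (Vf s l) : ℝ)) / finrank ℂ V + ε) * ‖x‖ ^ 2 := by
  have hn : (0 : ℝ) < finrank ℂ V := by exact_mod_cast finrank_pos
  have hsum : ∀ f : Fin m → ℕ → ℝ, ∑ j : Fin m × ↥(Finset.Icc 1 N), f j.1 j.2 =
      ∑ s, ∑ l ∈ Finset.Icc 1 N, f s l := by
    intro f
    rw [Fintype.sum_prod_type]
    refine Finset.sum_congr rfl fun s _ => ?_
    exact Finset.sum_coe_sort (Finset.Icc 1 N) (f s)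
  obtain ⟨φ, hφ⟩ := aux_good (fun j : Fin m × ↥(Finset.Icc 1 N) => Vf j.1 j.2)
    ((∑ s, ∑ l ∈ Finset.Icc 1 N, (finrank ℂ (Vf s l) : ℝ)) / finrank ℂ V) (by positivity)
    (fun H => by
      rw [hsum (fun s l => (finrank ℂ ↥(Vf s l ⊓ H) : ℝ))]
      by_cases hb : H = ⊥
      · subst hb
        have h0 : ∀ K : Submodule ℂ V, finrank ℂ ↥(K ⊓ ⊥) = 0 := fun K => by
          rw [inf_bot_eq, finrank_bot]
        simp [h0]
      by_cases ht : H = ⊤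
      · subst ht
        have h0 : ∀ K : Submodule ℂ V, finrank ℂ ↥(K ⊓ ⊤) = finrank ℂ K := fun K => by
          rw [inf_top_eq]
        rw [finrank_top, div_mul_cancel₀ _ hn.ne']
        simp only [h0, le_refl]
      have h1 := hss H hb ht
      have hH : (0 : ℝ) < finrank ℂ H := by
        have : Nontrivial H := Submodule.nontrivial_iff_ne_bot.mpr hb
        exact_mod_cast finrank_pos
      rw [← div_le_iff₀ hH]
      rw [← Rat.cast_le (K := ℝ)] at h1
      push_cast at h1
      exact h1)
    (by rw [hsum (fun s l => (finrank ℂ ↥(Vf s l) : ℝ)), div_mul_cancel₀ _ hn.ne']) ε hε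
  refine ⟨φ, fun x => ?_⟩
  rw [← hsum (fun s l => ‖((Vf s l).map φ.toLinearMap).starProjection x‖ ^ 2)]
  exact hφ x

lemma aux_map {V W E F : Type*} [AddCommGroup V] [Module ℂ V] [AddCommGroup W] [Module ℂ W]
    [AddCommGroup E] [Module ℂ E] [AddCommGroup F] [Module ℂ F] (φ : V ≃ₗ[ℂ] E) (ψ : W ≃ₗ[ℂ] F)
    (A : ℕ → Submodule ℂ V) (B : ℕ → Submodule ℂ W) (l : ℕ) :
    (⨆ (p : ℕ) (q : ℕ) (_ : p + q = l), prodSub (A p) (B q)).map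
      (TensorProduct.congr φ ψ).toLinearMap =
    ⨆ (p : ℕ) (q : ℕ) (_ : p + q = l),
      prodSub ((A p).map φ.toLinearMap) ((B q).map ψ.toLinearMap) := by
  simp only [Submodule.map_iSup]
  refine iSup_congr fun p => iSup_congr fun q => iSup_congr fun _ => ?_
  apply le_antisymm
  · rintro _ ⟨_, ⟨z, rfl⟩, rfl⟩
    induction z with
    | zero => simp
    | add x y hx hy => rw [map_add, map_add]; exact Submodule.add_mem _ hx hy
    | tmul x y =>
      exact ⟨(⟨φ x, x, x.2, rfl⟩ : (A p).map φ.toLinearMap) ⊗ₜ[ℂ]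
        (⟨ψ y, y, y.2, rfl⟩ : (B q).map ψ.toLinearMap), by simp⟩
  · rintro _ ⟨z, rfl⟩
    induction z with
    | zero => simp
    | add x y hx hy => rw [map_add]; exact Submodule.add_mem _ hx hy
    | tmul x y =>
      obtain ⟨_, x, hx, rfl⟩ := x
      obtain ⟨_, y, hy, rfl⟩ := y
      exact ⟨x ⊗ₜ[ℂ] y, ⟨(⟨x, hx⟩ : A p) ⊗ₜ[ℂ] (⟨y, hy⟩ : B q), by simp⟩, by simp⟩

end Helpers

/-- the tensor product of two semistable `m`-filtrations, namely
`(V⊗W)^l(s) = Σ_{p+q=l} V^p(s)·W^q(s)`, is a semistable `m`-filtration of `V ⊗ W`. -/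
theorem stmt_15 (V W : Type*) [AddCommGroup V] [Module ℂ V] [FiniteDimensional ℂ V] [Nontrivial V]
    [AddCommGroup W] [Module ℂ W] [FiniteDimensional ℂ W] [Nontrivial W]
    (m : ℕ) (hm : 1 ≤ m)
    (Vf : Fin m → ℕ → Submodule ℂ V) (Wf : Fin m → ℕ → Submodule ℂ W)
    (hVf : IsMFiltration m Vf) (hWf : IsMFiltration m Wf)
    (N : ℕ)
    (hVvan : ∀ s l, N ≤ l → Vf s l = ⊥) (hWvan : ∀ s l, N ≤ l → Wf s l = ⊥)
    (hVss : MFiltSemistable m N Vf) (hWss : MFiltSemistable m N Wf) :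
    MFiltSemistable m (2 * N)
      (fun s l => ⨆ (p : ℕ) (q : ℕ) (_ : p + q = l), prodSub (Vf s p) (Wf s q)) := by
  obtain ⟨hV0, hV1⟩ := hVf
  obtain ⟨hW0, hW1⟩ := hWf
  have hVa : ∀ s, Antitone (Vf s) := fun s => antitone_nat_of_succ_le (hV1 s)
  have hWa : ∀ s, Antitone (Wf s) := fun s => antitone_nat_of_succ_le (hW1 s)
  intro H hHb hHt
  have hnV : (0 : ℝ) < finrank ℂ V := by exact_mod_cast finrank_pos
  have hnW : (0 : ℝ) < finrank ℂ W := by exact_mod_cast finrank_pos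
  have hH : (0 : ℝ) < finrank ℂ H := by
    have : Nontrivial H := Submodule.nontrivial_iff_ne_bot.mpr hHb
    exact_mod_cast finrank_pos
  set a : ℝ := ∑ s, ∑ l ∈ Finset.Icc 1 N, (finrank ℂ (Vf s l) : ℝ) with ha
  set b : ℝ := ∑ s, ∑ l ∈ Finset.Icc 1 N, (finrank ℂ (Wf s l) : ℝ) with hb
  have main : ∀ ε : ℝ, 0 < ε → ∑ s, ∑ l ∈ Finset.Icc 1 (2 * N), (finrank ℂ
      ↥((⨆ (p : ℕ) (q : ℕ) (_ : p + q = l), prodSub (Vf s p) (Wf s q)) ⊓ H) : ℝ) ≤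
      ((a / finrank ℂ V + ε) + (b / finrank ℂ W + ε)) * finrank ℂ H := by
    intro ε hε
    obtain ⟨φ, hφ⟩ := aux_good' N Vf hVss ε hε
    obtain ⟨ψ, hψ⟩ := aux_good' N Wf hWss ε hε
    have := aux_ineq N (fun s l => (Vf s l).map φ.toLinearMap)
      (fun s l => (Wf s l).map ψ.toLinearMap)
      (fun s => by simp [hV0]) (fun s => by simp [hW0])
      (fun s _ _ h => Submodule.map_mono (hVa s h)) (fun s _ _ h => Submodule.map_mono (hWa s h))
      (fun s => by simp [hVvan s N le_rfl]) (fun s => by simp [hWvan s N le_rfl]) _ _ hφ hψ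
      (H.map (TensorProduct.congr φ ψ).toLinearMap)
    rw [LinearEquiv.finrank_map_eq] at this
    refine le_trans (le_of_eq ?_) this
    refine Finset.sum_congr rfl fun s _ => Finset.sum_congr rfl fun l _ => ?_
    rw [← aux_map, ← Submodule.map_inf _ (TensorProduct.congr φ ψ).injective,
      LinearEquiv.finrank_map_eq]
  have htot : ∑ s, ∑ l ∈ Finset.Icc 1 (2 * N), (finrank ℂ
      ↥(⨆ (p : ℕ) (q : ℕ) (_ : p + q = l), prodSub (Vf s p) (Wf s q)) : ℝ) =
      a * finrank ℂ W + finrank ℂ V * b := by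
    obtain ⟨φ, -⟩ := aux_good' N Vf hVss 1 one_pos
    obtain ⟨ψ, -⟩ := aux_good' N Wf hWss 1 one_pos
    rw [ha, hb, Finset.sum_mul, Finset.mul_sum, ← Finset.sum_add_distrib]
    refine Finset.sum_congr rfl fun s _ => ?_
    have := aux_total (fun l => (Vf s l).map φ.toLinearMap)
      (fun l => (Wf s l).map ψ.toLinearMap)
      (by simp [hV0]) (by simp [hW0])
      (fun _ _ h => Submodule.map_mono (hVa s h)) (fun _ _ h => Submodule.map_mono (hWa s h)) N
      (by simp [hVvan s N le_rfl]) (by simp [hWvan s N le_rfl])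
    have h2 : ∀ l, finrank ℂ ↥(⨆ (p : ℕ) (q : ℕ) (_ : p + q = l),
        prodSub ((Vf s p).map φ.toLinearMap) ((Wf s q).map ψ.toLinearMap)) =
        finrank ℂ ↥(⨆ (p : ℕ) (q : ℕ) (_ : p + q = l), prodSub (Vf s p) (Wf s q)) := fun l => by
      rw [← aux_map φ ψ (Vf s) (Wf s) l, LinearEquiv.finrank_map_eq]
    rw [Finset.sum_congr rfl fun l _ => h2 l] at this
    simp only [LinearEquiv.finrank_map_eq, finrank_euclideanSpace_fin] at this
    exact_mod_cast this
  have fin : ∑ s, ∑ l ∈ Finset.Icc 1 (2 * N), (finrank ℂ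
      ↥((⨆ (p : ℕ) (q : ℕ) (_ : p + q = l), prodSub (Vf s p) (Wf s q)) ⊓ H) : ℝ) ≤
      (a / finrank ℂ V + b / finrank ℂ W) * finrank ℂ H := by
    refine le_of_forall_pos_le_add fun δ hδ => ?_
    refine le_trans (main (δ / (2 * finrank ℂ H)) (by positivity)) (le_of_eq ?_)
    field_simp
    ring
  have goal : (∑ s, ∑ l ∈ Finset.Icc 1 (2 * N), (finrank ℂ
      ↥((⨆ (p : ℕ) (q : ℕ) (_ : p + q = l), prodSub (Vf s p) (Wf s q)) ⊓ H) : ℝ)) / finrank ℂ H ≤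
      (∑ s, ∑ l ∈ Finset.Icc 1 (2 * N), (finrank ℂ
      ↥(⨆ (p : ℕ) (q : ℕ) (_ : p + q = l), prodSub (Vf s p) (Wf s q)) : ℝ)) /
        finrank ℂ (V ⊗[ℂ] W) := by
    rw [div_le_iff₀ hH, htot, finrank_tensorProduct]
    refine le_trans fin (le_of_eq ?_)
    push_cast
    field_simp
  rw [← Rat.cast_le (K := ℝ)]
  push_cast
  exact goal
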